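/- arXiv:2507.05669 — 11 statements merged into one kernel-verified Lean document; each statement's English description precedes it below -/
import Mathlib

section
/- Let Q ⊆ ℝⁿ be a convex set, h : ℝⁿ → ℝ a differentiable convex reference function, and V(x,y) = h(x) − h(y) − ⟨∇h(y), x − y⟩ its Bregman divergence. Suppose f : ℝⁿ → ℝ is differentiable and L-relatively smooth on Q (i.e. f(x) ≤ f(y) + ⟨∇f(y), x − y⟩ + L·V(x,y) for all x,y ∈ Q) and that V satisfies the triangle scaling property with exponent γ ∈ (1,2] on Q (i.e. V((1−θ)x + θz, (1−θ)x + θz̃) ≤ θ^γ · V(z,z̃) for all θ ∈ [0,1] and x,z,z̃ ∈ Q). Then for every x ∈ Q, every s ∈ Q with d = s − x, and every α ∈ [0,1] with x + αd ∈ Q, it holds that f(x + αd) ≤ f(x) + α⟨∇f(x), d⟩ + α^γ · L · V(x + d, x). -/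
open RealInnerProductSpace

/-- If `f` is `L`-relatively smooth on a convex set `Q` with respect to the
Bregman divergence `V` of a differentiable convex reference function `href`, and `V` has the
triangle scaling property with exponent `γ ∈ (1,2]` on `Q`, then for `x, s ∈ Q`, `d = s - x`,
`α ∈ [0,1]` with `x + α • d ∈ Q`, one has
`f (x + α • d) ≤ f x + α * ⟪∇f x, d⟫ + α ^ γ * L * V (x + d) x`. -/
theorem stmt0 (n : ℕ) (Q : Set (EuclideanSpace ℝ (Fin n))) (hQconv : Convex ℝ Q)
    (href : EuclideanSpace ℝ (Fin n) → ℝ) (hrefDiff : Differentiable ℝ href)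
    (hrefConv : ConvexOn ℝ Set.univ href)
    (V : EuclideanSpace ℝ (Fin n) → EuclideanSpace ℝ (Fin n) → ℝ)
    (hV : ∀ x y, V x y = href x - href y - ⟪gradient href y, x - y⟫)
    (f : EuclideanSpace ℝ (Fin n) → ℝ) (hfDiff : Differentiable ℝ f)
    (L : ℝ) (hL : 0 < L)
    (hrs : ∀ x ∈ Q, ∀ y ∈ Q, f x ≤ f y + ⟪gradient f y, x - y⟫ + L * V x y)
    (γ : ℝ) (hγ : γ ∈ Set.Ioc (1 : ℝ) 2)
    (hTSE : ∀ θ ∈ Set.Icc (0 : ℝ) 1, ∀ x ∈ Q, ∀ z ∈ Q, ∀ z' ∈ Q,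
      V ((1 - θ) • x + θ • z) ((1 - θ) • x + θ • z') ≤ θ ^ γ * V z z')
    (x : EuclideanSpace ℝ (Fin n)) (hx : x ∈ Q)
    (s : EuclideanSpace ℝ (Fin n)) (hs : s ∈ Q)
    (α : ℝ) (hα : α ∈ Set.Icc (0 : ℝ) 1)
    (hxα : x + α • (s - x) ∈ Q) :
    f (x + α • (s - x)) ≤
      f x + α * ⟪gradient f x, s - x⟫ + α ^ γ * L * V (x + (s - x)) x := by
  have hsmooth := hrs _ hxα x hx
  have hscale := hTSE α hα x hx s hs x hx
  have hpoint : (1 - α) • x + α • s = x + α • (s - x) := by module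
  have hbase : (1 - α) • x + α • x = x := by module
  rw [hpoint, hbase] at hscale
  rw [add_sub_cancel_left, real_inner_smul_right] at hsmooth
  rw [add_sub_cancel]
  linarith [mul_le_mul_of_nonneg_left hscale hL.le]
end

section
/- Let Q ⊆ ℝⁿ be convex and compact, V the Bregman divergence of a differentiable convex h, and f differentiable, L-relatively smooth on Q with V satisfying the triangle scaling property with exponent γ ∈ (1,2]. Fix x ∈ Q, let s ∈ Q minimize z ↦ ⟨∇f(x), z⟩ over Q, set d = s − x, assume V(s,x) > 0, and define the step size α = min{ ( −⟨∇f(x), d⟩ / (2L·V(s,x)) )^{1/(γ−1)}, 1 }. Then the next iterate x⁺ = x + αd satisfies f(x⁺) − f(x) ≤ ⟨∇f(x), d⟩ · min{ 1/2, (1/2)·( −⟨∇f(x), d⟩ / (2L·V(s,x)) )^{1/(γ−1)} }. -/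
open RealInnerProductSpace

/-- If `0 ≤ a ≤ r ^ (1 / (p - 1))` with `p > 1`, then `a ^ p ≤ a * r`. -/
theorem Real.rpow_le_mul_of_le_rpow_one_div_sub_one {a r p : ℝ} (ha : 0 ≤ a) (hr : 0 ≤ r)
    (hp : 1 < p) (h : a ≤ r ^ (1 / (p - 1))) : a ^ p ≤ a * r := by
  have hp' : 0 < p - 1 := sub_pos.2 hp
  have hle : a ^ (p - 1) ≤ r := by
    calc a ^ (p - 1) ≤ (r ^ (1 / (p - 1))) ^ (p - 1) := Real.rpow_le_rpow ha h hp'.le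
      _ = r := by rw [one_div, Real.rpow_inv_rpow hr hp'.ne']
  calc a ^ p = a * a ^ (p - 1) := by
        rw [← Real.rpow_one_add' ha (by linarith)]
        congr 1
        ring
    _ ≤ a * r := mul_le_mul_of_nonneg_left hle ha

/-- Progress lemma: for the adaptive Bregman step size
`α = min ((−⟪∇f x, d⟫ / (2 L V(s,x)))^(1/(γ−1))) 1` with Frank–Wolfe direction `d = s − x`,
the next iterate `x⁺ = x + α • d` satisfies
`f x⁺ − f x ≤ ⟪∇f x, d⟫ * min (1/2) ((1/2) * (−⟪∇f x, d⟫/(2 L V(s,x)))^(1/(γ−1)))`. -/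
theorem stmt1 (n : ℕ) (Q : Set (EuclideanSpace ℝ (Fin n)))
    (hQconv : Convex ℝ Q) (hQcomp : IsCompact Q)
    (href : EuclideanSpace ℝ (Fin n) → ℝ) (hrefDiff : Differentiable ℝ href)
    (hrefConv : ConvexOn ℝ Set.univ href)
    (V : EuclideanSpace ℝ (Fin n) → EuclideanSpace ℝ (Fin n) → ℝ)
    (hV : ∀ x y, V x y = href x - href y - ⟪gradient href y, x - y⟫)
    (f : EuclideanSpace ℝ (Fin n) → ℝ) (hfDiff : Differentiable ℝ f)
    (L : ℝ) (hL : 0 < L)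
    (hrs : ∀ x ∈ Q, ∀ y ∈ Q, f x ≤ f y + ⟪gradient f y, x - y⟫ + L * V x y)
    (γ : ℝ) (hγ : γ ∈ Set.Ioc (1 : ℝ) 2)
    (hTSE : ∀ θ ∈ Set.Icc (0 : ℝ) 1, ∀ x ∈ Q, ∀ z ∈ Q, ∀ z' ∈ Q,
      V ((1 - θ) • x + θ • z) ((1 - θ) • x + θ • z') ≤ θ ^ γ * V z z')
    (x : EuclideanSpace ℝ (Fin n)) (hx : x ∈ Q)
    (s : EuclideanSpace ℝ (Fin n)) (hs : s ∈ Q)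
    (hsmin : ∀ z ∈ Q, ⟪gradient f x, s⟫ ≤ ⟪gradient f x, z⟫)
    (hVpos : 0 < V s x)
    (α : ℝ)
    (hα : α = min ((-⟪gradient f x, s - x⟫ / (2 * L * V s x)) ^ (1 / (γ - 1))) 1) :
    f (x + α • (s - x)) - f x ≤
      ⟪gradient f x, s - x⟫ *
        min (1 / 2)
          ((1 / 2) * (-⟪gradient f x, s - x⟫ / (2 * L * V s x)) ^ (1 / (γ - 1))) := by
  have hg : ⟪gradient f x, s - x⟫ ≤ 0 := by
    rw [inner_sub_right]
    exact sub_nonpos.2 (hsmin x hx)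
  have hmin : min (1 / 2)
      ((1 / 2) * (-⟪gradient f x, s - x⟫ / (2 * L * V s x)) ^ (1 / (γ - 1))) = 1 / 2 * α := by
    rw [hα, mul_min_of_nonneg _ _ (by norm_num), mul_one, min_comm]
  rw [hmin]
  set g := ⟪gradient f x, s - x⟫ with hgdef
  have hr : 0 ≤ -g / (2 * L * V s x) := div_nonneg (neg_nonneg.2 hg) (by positivity)
  have hα0 : 0 ≤ α := hα ▸ le_min (Real.rpow_nonneg hr _) zero_le_one
  have hα1 : α ≤ 1 := hα ▸ min_le_right _ _
  have hpow : α ^ γ ≤ α * (-g / (2 * L * V s x)) :=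
    Real.rpow_le_mul_of_le_rpow_one_div_sub_one hα0 hr hγ.1 (hα.le.trans (min_le_left _ _))
  have hnext : (1 - α) • x + α • s = x + α • (s - x) := by module
  have hmem : x + α • (s - x) ∈ Q := hQconv.add_smul_sub_mem hx hs ⟨hα0, hα1⟩
  have hscale : V (x + α • (s - x)) x ≤ α ^ γ * V s x := by
    have h := hTSE α ⟨hα0, hα1⟩ x hx s hs x hx
    rwa [hnext, show (1 - α) • x + α • x = x by module] at h
  have hsmooth := hrs _ hmem x hx
  rw [add_sub_cancel_left, inner_smul_right, ← hgdef] at hsmooth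
  have hbound : L * V (x + α • (s - x)) x ≤ -(α * g) / 2 :=
    calc L * V (x + α • (s - x)) x ≤ L * (α * (-g / (2 * L * V s x)) * V s x) := by
          gcongr
          exact hscale.trans (by gcongr)
      _ = -(α * g) / 2 := by field_simp
  linarith
end

section
/- Let γ ∈ (1,2], K > 0, and let (h_k)_{k≥0} be a sequence of real numbers such that 0 < h_k < K for all k and satisfying the recurrence h_{k+1} ≤ h_k · (1 − (h_k/K)^{1/(γ−1)}) for all k ≥ 0. Then for every k ≥ 0, h_k ≤ (2/(k+2))^{γ−1} · K. -/
theorem le_two_div_of_le_mul_one_sub (x : ℕ → ℝ) (hpos : ∀ k, 0 < x k) (h0 : x 0 ≤ 1)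
    (hrec : ∀ k, x (k + 1) ≤ x k * (1 - x k)) (k : ℕ) : x k ≤ 2 / (k + 2 : ℝ) := by
  induction k with
  | zero => simpa using h0
  | succ k ih =>
    have hk : (0 : ℝ) ≤ k := k.cast_nonneg
    have hx := hpos k
    rw [le_div_iff₀ (by positivity)] at ih ⊢
    push_cast
    calc x (k + 1) * (k + 1 + 2) ≤ x k * (1 - x k) * (k + 1 + 2) := by gcongr; exact hrec k
      _ = (1 - x k) * (x k * (k + 2) + x k) := by ring
      _ ≤ 2 := by
        have h1 : 0 < 1 - x k := pos_of_mul_pos_right ((hpos (k + 1)).trans_le (hrec k)) hx.le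
        nlinarith [mul_le_mul_of_nonneg_left ih h1.le]


/-- If `γ ∈ (1,2]`, `K > 0`, and `(h k)` is a sequence with `0 < h k < K`
satisfying `h (k+1) ≤ h k * (1 − (h k / K)^(1/(γ−1)))`, then
`h k ≤ (2/(k+2))^(γ−1) * K` for every `k`. -/
theorem stmt2 (γ K : ℝ) (hγ1 : 1 < γ) (hγ2 : γ ≤ 2) (hK : 0 < K)
    (h : ℕ → ℝ) (hpos : ∀ k, 0 < h k) (hlt : ∀ k, h k < K)
    (hrec : ∀ k, h (k + 1) ≤ h k * (1 - (h k / K) ^ (1 / (γ - 1)))) :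
    ∀ k, h k ≤ (2 / (k + 2 : ℝ)) ^ (γ - 1) * K := by
  have ha : 0 < γ - 1 := by linarith
  have hq (k : ℕ) : 0 < h k / K := div_pos (hpos k) hK
  let x : ℕ → ℝ := fun k => (h k / K) ^ (1 / (γ - 1))
  have hx (k : ℕ) : 0 < x k := Real.rpow_pos_of_pos (hq k) _
  have hx1 (k : ℕ) : x k < 1 :=
    Real.rpow_lt_one (hq k).le ((div_lt_one hK).2 (hlt k)) (by positivity)
  have hxrec (k : ℕ) : x (k + 1) ≤ x k * (1 - x k) := by
    have h1 : 0 < 1 - x k := sub_pos.2 (hx1 k)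
    calc x (k + 1) ≤ (h k / K * (1 - x k)) ^ (1 / (γ - 1)) := by
          refine Real.rpow_le_rpow (hq _).le ?_ (by positivity)
          rw [div_mul_eq_mul_div]
          exact div_le_div_of_nonneg_right (hrec k) hK.le
      _ = x k * (1 - x k) ^ (1 / (γ - 1)) := Real.mul_rpow (hq k).le h1.le
      _ ≤ x k * (1 - x k) := by
          refine mul_le_mul_of_nonneg_left ?_ (hx k).le
          refine Real.rpow_le_self_of_le_one h1.le (by linarith [hx k]) ?_
          rw [le_div_iff₀ ha]
          linarith
  intro k
  have hle := Real.rpow_le_rpow (hx k).le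
    (le_two_div_of_le_mul_one_sub x hx (hx1 0).le hxrec k) ha.le
  rwa [← Real.rpow_mul (hq k).le, one_div_mul_cancel ha.ne', Real.rpow_one,
    div_le_iff₀ hK] at hle
end

section
/- Let Q ⊆ ℝⁿ be convex and compact, h differentiable convex with Bregman divergence V satisfying V(x,y) ≤ R²/2 for all x,y ∈ Q, and let f be convex and differentiable with minimizer x* over Q and optimal value f* = f(x*). Suppose sequences (x_k) ⊆ Q, (s_k), (L_k), (γ_k), (α_k) satisfy for every k ≥ 0: L_k > 0, γ_k ∈ (1,2], s_k minimizes z ↦ ⟨∇f(x_k), z⟩ over Q, d_k = s_k − x_k, V(s_k, x_k) > 0, α_k = min{ ( −⟨∇f(x_k), d_k⟩ / (2L_k·V(s_k,x_k)) )^{1/(γ_k−1)}, 1 }, x_{k+1} = x_k + α_k d_k, and the accepted line-search inequality f(x_{k+1}) ≤ f(x_k) + α_k⟨∇f(x_k), d_k⟩ + α_k^{γ_k}·L_k·V(s_k, x_k) holds. Then for every k ≥ 1, f(x_k) − f* ≤ (2/(k+2))^{γ_min − 1} · L_max · R², where L_max = max_{0≤i≤k} L_i and γ_min = min_{0≤i≤k}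 γ_i. -/
open RealInnerProductSpace

/-- The first-order characterization of convexity, in terms of the gradient. -/
theorem ConvexOn.add_inner_gradient_le {E : Type*} [NormedAddCommGroup E] [InnerProductSpace ℝ E]
    [CompleteSpace E] {f : E → ℝ} (hf : ConvexOn ℝ Set.univ f) {x : E}
    (hfx : DifferentiableAt ℝ f x) (y : E) : f x + ⟪gradient f x, y - x⟫ ≤ f y := by
  have hconv : ConvexOn ℝ Set.univ (f ∘ AffineMap.lineMap (k := ℝ) x y) := by
    simpa using hf.comp_affineMap (AffineMap.lineMap (k := ℝ) x y)
  have hderiv : HasDerivAt (f ∘ AffineMap.lineMap (k := ℝ) x y) ⟪gradient f x, y - x⟫ 0 := by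
    have h₁ : HasDerivAt (AffineMap.lineMap (k := ℝ) x y) (y - x) 0 := AffineMap.hasDerivAt_lineMap
    have h₂ : HasFDerivAt f (InnerProductSpace.toDual ℝ E (gradient f x))
        (AffineMap.lineMap (k := ℝ) x y 0) := by
      simpa using hfx.hasGradientAt.hasFDerivAt
    simpa using h₂.comp_hasDerivAt (0 : ℝ) h₁
  have h := hconv.le_slope_of_hasDerivAt (Set.mem_univ 0) (Set.mem_univ 1) one_pos hderiv
  simp only [slope_def_field, Function.comp_apply, AffineMap.lineMap_apply_zero,
    AffineMap.lineMap_apply_one, sub_zero, div_one] at h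
  linarith

section AdaptiveStep

variable {g c α γ : ℝ}

/-- The adaptive step realizes at least half of the linear decrease. -/
theorem adaptiveStep_decrease (hg : 0 ≤ g) (hc : 0 < c) (hγ : 1 < γ)
    (hα : α = min ((g / (2 * c)) ^ (1 / (γ - 1))) 1) : α ^ γ * c ≤ α * g / 2 := by
  have hq : 0 ≤ g / (2 * c) := by positivity
  have hα0 : 0 ≤ α := by rw [hα]; positivity
  have hpow : α ^ (γ - 1) ≤ g / (2 * c) := by
    rw [← Real.le_rpow_inv_iff_of_pos hα0 hq (by linarith), ← one_div, hα]
    exact min_le_left _ _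
  have hsplit : α ^ γ = α * α ^ (γ - 1) := by
    rw [← Real.rpow_one_add' hα0 (by linarith)]
    ring_nf
  calc α ^ γ * c = α * (α ^ (γ - 1) * c) := by rw [hsplit, mul_assoc]
    _ ≤ α * (g / (2 * c) * c) := by gcongr
    _ = α * g / 2 := by field_simp

/-- A lower bound on the adaptive step, with the exponent `γ - 1` replaced by a smaller one. -/
theorem le_adaptiveStep {p w : ℝ} (hg : 0 ≤ g) (hc : 0 < c) (hp : 0 < p) (hpγ : p ≤ γ - 1)
    (hα : α = min ((g / (2 * c)) ^ (1 / (γ - 1))) 1) (hw0 : 0 ≤ w) (hw1 : w ≤ 1)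
    (hw : w ^ p ≤ g / (2 * c)) : w ≤ α := by
  rw [hα, le_min_iff, one_div, Real.le_rpow_inv_iff_of_pos hw0 (by positivity) (by linarith)]
  exact ⟨(Real.rpow_le_rpow_of_exponent_ge_of_imp hw0 hw1 hpγ
    fun _ h => absurd h (by linarith)).trans hw, hw1⟩

variable {δ δ' B p : ℝ}

/-- One step of the recursion satisfied by the functional gap `δ`: the rate `2 / (k + 2)` is
propagated. -/
theorem adaptiveStep_gap_succ_le (hδ : 0 ≤ δ) (hδg : δ ≤ g) (hc : 0 < c) (hcB : 2 * c ≤ B)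
    (hp : 0 < p) (hp1 : p ≤ 1) (hpγ : p ≤ γ - 1)
    (hα : α = min ((g / (2 * c)) ^ (1 / (γ - 1))) 1)
    (hδ' : δ' ≤ δ - α * g + α ^ γ * c) {k : ℕ} (hk : δ ≤ (2 / (k + 2 : ℝ)) ^ p * B) :
    δ' ≤ (2 / (k + 3 : ℝ)) ^ p * B := by
  have hB : 0 < B := by linarith
  have hg : 0 ≤ g := hδ.trans hδg
  have hkpos : (0 : ℝ) < k + 2 := by positivity
  set v : ℝ := (δ / B) ^ p⁻¹ with hv
  have hv0 : 0 ≤ v := by positivity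
  have hvp : v ^ p = δ / B := Real.rpow_inv_rpow (by positivity) hp.ne'
  have hvk : v ≤ 2 / (k + 2) := by
    rw [hv, Real.rpow_inv_le_iff_of_pos (by positivity) (by positivity) hp]
    exact (div_le_iff₀ hB).2 hk
  have hv1 : v ≤ 1 := hvk.trans ((div_le_one hkpos).2 (by linarith [k.cast_nonneg (α := ℝ)]))
  have hvα : v ≤ α := le_adaptiveStep hg hc hp hpγ hα hv0 hv1 (hvp.trans_le (by gcongr))
  have hdec := adaptiveStep_decrease hg hc (by linarith) hα
  have hmul : v * δ ≤ α * g := by gcongr; exact hv0.trans hvα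
  have hrate : (1 - v / 2) * v ≤ 2 / (k + 3) := by
    calc (1 - v / 2) * v ≤ (1 - 2 / (k + 2 : ℝ) / 2) * (2 / (k + 2)) := by
          nlinarith [(div_le_one hkpos).2 (by linarith [k.cast_nonneg (α := ℝ)] : (2 : ℝ) ≤ k + 2)]
      _ ≤ 2 / (k + 3) := by
          rw [show (1 - 2 / (k + 2 : ℝ) / 2) * (2 / (k + 2)) = 2 * (k + 1) / (k + 2) ^ 2 by
            field_simp; ring, div_le_div_iff₀ (by positivity) (by positivity)]
          nlinarith
  calc δ' ≤ (1 - v / 2) * δ := by linarith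
    _ = (1 - v / 2) * v ^ p * B := by rw [hvp]; field_simp
    _ ≤ (1 - v / 2) ^ p * v ^ p * B := by
        gcongr
        exact Real.self_le_rpow_of_le_one (by linarith) (by linarith) hp1
    _ = ((1 - v / 2) * v) ^ p * B := by rw [Real.mul_rpow (by linarith) hv0]
    _ ≤ (2 / (k + 3 : ℝ)) ^ p * B := by
        gcongr
        exact mul_nonneg (by linarith) hv0

/-- The first step brings the gap below the rate, whatever its initial value. -/
theorem adaptiveStep_gap_one_le (hδ : 0 ≤ δ) (hδg : δ ≤ g) (hc : 0 < c) (hcB : 2 * c ≤ B)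
    (hp : 0 < p) (hp1 : p ≤ 1) (hpγ : p ≤ γ - 1)
    (hα : α = min ((g / (2 * c)) ^ (1 / (γ - 1))) 1)
    (hδ' : δ' ≤ δ - α * g + α ^ γ * c) : δ' ≤ (2 / 3 : ℝ) ^ p * B := by
  have hB : 0 < B := by linarith
  rcases le_total δ B with h | h
  · simpa using adaptiveStep_gap_succ_le (k := 0) hδ hδg hc hcB hp hp1 hpγ hα hδ' (by simpa using h)
  · have hα1 : α = 1 := le_antisymm (hα ▸ min_le_right _ _) <|
      le_adaptiveStep (hδ.trans hδg) hc hp hpγ hα zero_le_one le_rfl <| by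
        rw [Real.one_rpow, one_le_div (by positivity)]
        linarith
    rw [hα1, Real.one_rpow] at hδ'
    calc δ' ≤ 2 / 3 * B := by linarith
      _ ≤ (2 / 3 : ℝ) ^ p * B := by
        gcongr
        exact Real.self_le_rpow_of_le_one (by norm_num) (by norm_num) hp1

end AdaptiveStep

/-- Sublinear convergence of the fully adaptive Frank–Wolfe method:
under the adaptive step-size rule and the accepted line-search inequality, for every `k ≥ 1`,
`f (x k) − f* ≤ (2/(k+2))^(γ_min − 1) * L_max * R²`, where `L_max = max_{0≤i≤k} L i` and
`γ_min = min_{0≤i≤k} γ i`. -/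
theorem stmt3 (n : ℕ) (Q : Set (EuclideanSpace ℝ (Fin n)))
    (hQconv : Convex ℝ Q) (hQcomp : IsCompact Q)
    (href : EuclideanSpace ℝ (Fin n) → ℝ) (hrefDiff : Differentiable ℝ href)
    (hrefConv : ConvexOn ℝ Set.univ href)
    (V : EuclideanSpace ℝ (Fin n) → EuclideanSpace ℝ (Fin n) → ℝ)
    (hV : ∀ x y, V x y = href x - href y - ⟪gradient href y, x - y⟫)
    (R : ℝ) (hR : ∀ x ∈ Q, ∀ y ∈ Q, V x y ≤ R ^ 2 / 2)
    (f : EuclideanSpace ℝ (Fin n) → ℝ) (hfDiff : Differentiable ℝ f)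
    (hfConv : ConvexOn ℝ Set.univ f)
    (xstar : EuclideanSpace ℝ (Fin n)) (hxstarQ : xstar ∈ Q)
    (hxstarMin : ∀ y ∈ Q, f xstar ≤ f y)
    (x s : ℕ → EuclideanSpace ℝ (Fin n)) (L γ α : ℕ → ℝ)
    (hxQ : ∀ k, x k ∈ Q) (hsQ : ∀ k, s k ∈ Q)
    (hL : ∀ k, 0 < L k) (hγ : ∀ k, γ k ∈ Set.Ioc (1 : ℝ) 2)
    (hsmin : ∀ k, ∀ z ∈ Q, ⟪gradient f (x k), s k⟫ ≤ ⟪gradient f (x k), z⟫)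
    (hVpos : ∀ k, 0 < V (s k) (x k))
    (hα : ∀ k, α k =
      min ((-⟪gradient f (x k), s k - x k⟫ / (2 * L k * V (s k) (x k))) ^ (1 / (γ k - 1))) 1)
    (hupd : ∀ k, x (k + 1) = x k + α k • (s k - x k))
    (hacc : ∀ k, f (x (k + 1)) ≤
      f (x k) + α k * ⟪gradient f (x k), s k - x k⟫ + α k ^ γ k * L k * V (s k) (x k)) :
    ∀ k ≥ 1, f (x k) - f xstar ≤
      (2 / (k + 2 : ℝ)) ^ ((Finset.range (k + 1)).inf' (by simp) γ - 1) *
        (Finset.range (k + 1)).sup' (by simp) L * R ^ 2 := by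
  intro k hk
  set p : ℝ := (Finset.range (k + 1)).inf' (by simp) γ - 1 with hp_def
  set M : ℝ := (Finset.range (k + 1)).sup' (by simp) L with hM_def
  have hp : 0 < p := by
    rw [hp_def, sub_pos, Finset.lt_inf'_iff]
    exact fun i _ => (hγ i).1
  have hpγ : ∀ i ≤ k, p ≤ γ i - 1 := fun i hi =>
    sub_le_sub_right (Finset.inf'_le γ (Finset.mem_range.2 (by omega))) 1
  have hp1 : p ≤ 1 := by linarith [hpγ 0 k.zero_le, (hγ 0).2]
  have hLM : ∀ i ≤ k, L i ≤ M := fun i hi => Finset.le_sup' L (Finset.mem_range.2 (by omega))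
  have hgap : ∀ i, 0 ≤ f (x i) - f xstar := fun i => sub_nonneg.2 (hxstarMin _ (hxQ i))
  have hgapLe : ∀ i, f (x i) - f xstar ≤ -⟪gradient f (x i), s i - x i⟫ := fun i => by
    have h₁ := hfConv.add_inner_gradient_le (hfDiff (x i)) xstar
    have h₂ := hsmin i xstar hxstarQ
    rw [inner_sub_right] at h₁ ⊢
    linarith
  have hc : ∀ i, 0 < L i * V (s i) (x i) := fun i => mul_pos (hL i) (hVpos i)
  have hcB : ∀ i ≤ k, 2 * (L i * V (s i) (x i)) ≤ M * R ^ 2 := fun i hi => by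
    have h := mul_le_mul (hLM i hi) (hR _ (hsQ i) _ (hxQ i)) (hVpos i).le
      ((hL i).le.trans (hLM i hi))
    linarith
  have hα' : ∀ i, α i =
      min ((-⟪gradient f (x i), s i - x i⟫ / (2 * (L i * V (s i) (x i)))) ^ (1 / (γ i - 1))) 1 :=
    fun i => by rw [hα i, mul_assoc]
  have hstep : ∀ i, f (x (i + 1)) - f xstar ≤ f (x i) - f xstar
      - α i * -⟪gradient f (x i), s i - x i⟫ + α i ^ γ i * (L i * V (s i) (x i)) := fun i => by
    linarith [hacc i]
  have hrate : ∀ i, 1 ≤ i → i ≤ k → f (x i) - f xstar ≤ (2 / (i + 2 : ℝ)) ^ p * (M * R ^ 2) := by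
    intro i hi
    induction i, hi using Nat.le_induction with
    | base =>
      intro h
      have := adaptiveStep_gap_one_le (hgap 0) (hgapLe 0) (hc 0) (hcB 0 k.zero_le) hp hp1
        (hpγ 0 k.zero_le) (hα' 0) (hstep 0)
      norm_num at this ⊢
      exact this
    | succ i hi ih =>
      intro h
      have hik : i ≤ k := by omega
      have := adaptiveStep_gap_succ_le (hgap i) (hgapLe i) (hc i) (hcB i hik) hp hp1 (hpγ i hik)
        (hα' i) (hstep i) (ih hik)
      rwa [Nat.cast_succ, add_assoc, show (1 : ℝ) + 2 = 3 by norm_num]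
  rw [mul_assoc]
  exact hrate k hk le_rfl
end

section
/- Let Q ⊆ ℝⁿ be convex and compact, f convex and differentiable, x* a minimizer of f over Q, and x ∈ Q. Set g = −∇f(x) and suppose g ≠ 0. Let δ > 0 be such that x* + δ·(g/‖g‖) ∈ Q, and let s ∈ Q maximize z ↦ ⟨g, z⟩ over Q, with d = s − x. Then ⟨g, d⟩ ≥ δ‖g‖ + f(x) − f(x*); in particular ⟨g, d⟩ ≥ δ‖g‖. -/
open RealInnerProductSpace

/-- First-order condition: a convex function lies above its tangent hyperplanes. -/
theorem ConvexOn.inner_gradient_le_sub {E : Type*} [NormedAddCommGroup E] [InnerProductSpace ℝ E]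
    [CompleteSpace E] {f : E → ℝ} (hf : ConvexOn ℝ Set.univ f) {x : E}
    (hx : DifferentiableAt ℝ f x) (y : E) : ⟪gradient f x, y - x⟫ ≤ f y - f x := by
  have hconv : ConvexOn ℝ Set.univ (f ∘ AffineMap.lineMap (k := ℝ) x y) := by
    simpa using hf.comp_affineMap (AffineMap.lineMap (k := ℝ) x y)
  have hderiv : HasDerivAt (f ∘ AffineMap.lineMap (k := ℝ) x y) ⟪gradient f x, y - x⟫ 0 := by
    have h : HasFDerivAt f (InnerProductSpace.toDual ℝ E (gradient f x))
        (AffineMap.lineMap (k := ℝ) x y 0) := by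
      simpa using hx.hasGradientAt.hasFDerivAt
    simpa using h.comp_hasDerivAt (0 : ℝ) AffineMap.hasDerivAt_lineMap
  simpa [slope_def_field] using
    hconv.le_slope_of_hasDerivAt (Set.mem_univ 0) (Set.mem_univ 1) zero_lt_one hderiv

/-- with `g = −∇f x ≠ 0`, if `xstar + δ • (g/‖g‖) ∈ Q` and `s` maximizes
`⟪g, ·⟫` over `Q`, then for `d = s − x` one has `⟪g, d⟫ ≥ δ‖g‖ + f x − f xstar`, and in
particular `⟪g, d⟫ ≥ δ‖g‖`. -/
theorem stmt5 (n : ℕ) (Q : Set (EuclideanSpace ℝ (Fin n)))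
    (hQconv : Convex ℝ Q) (hQcomp : IsCompact Q)
    (f : EuclideanSpace ℝ (Fin n) → ℝ) (hfDiff : Differentiable ℝ f)
    (hfConv : ConvexOn ℝ Set.univ f)
    (xstar : EuclideanSpace ℝ (Fin n)) (hxstarQ : xstar ∈ Q)
    (hxstarMin : ∀ y ∈ Q, f xstar ≤ f y)
    (x : EuclideanSpace ℝ (Fin n)) (hx : x ∈ Q)
    (hg : -gradient f x ≠ 0)
    (δ : ℝ) (hδ : 0 < δ)
    (hδQ : xstar + δ • (‖-gradient f x‖⁻¹ • (-gradient f x)) ∈ Q)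
    (s : EuclideanSpace ℝ (Fin n)) (hs : s ∈ Q)
    (hsmax : ∀ z ∈ Q, ⟪-gradient f x, z⟫ ≤ ⟪-gradient f x, s⟫) :
    ⟪-gradient f x, s - x⟫ ≥ δ * ‖-gradient f x‖ + (f x - f xstar) ∧
      ⟪-gradient f x, s - x⟫ ≥ δ * ‖-gradient f x‖ := by
  have hmax := hsmax _ hδQ
  have htangent := hfConv.inner_gradient_le_sub (hfDiff x) xstar
  have hmin := hxstarMin x hx
  have hnorm : ‖-gradient f x‖⁻¹ * ‖-gradient f x‖ ^ 2 = ‖-gradient f x‖ := by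
    have := norm_ne_zero_iff.mpr hg
    field_simp
  rw [inner_add_right, real_inner_smul_right, real_inner_smul_right,
    real_inner_self_eq_norm_sq, hnorm] at hmax
  have hmain : ⟪-gradient f x, s - x⟫ ≥ δ * ‖-gradient f x‖ + (f x - f xstar) := by
    rw [inner_sub_right] at htangent ⊢
    simp only [inner_neg_left] at hmax ⊢
    linarith
  exact ⟨hmain, by linarith⟩
end

section
/- Let Q ⊆ ℝⁿ be convex and compact with boundary ∂Q, h differentiable convex with Bregman divergence V, f convex and differentiable, and x* an interior (in the Euclidean sense) minimizer of f over Q. Let δ = dist(x*, ∂Q) = inf_{y ∈ ∂Q} ‖x* − y‖ > 0, D = max_{x,y ∈ Q} ‖x − y‖, D_V = max_{x,y ∈ Q} V(x,y), and let ε > 0. Fix x ∈ Q with x ≠ x*, g = −∇f(x) ≠ 0, and V(x*, x) > ε. Let s ∈ Q maximize z ↦ ⟨g, z⟩ over Q, d = s − x, and assume V(s, x) > 0. Then the scaling condition holds with τ = (δ/D)·(ε/D_V): ⟨g, d⟩ / V(s, x) ≥ (δ/D)·(ε/D_V) · ⟨g, x* − x⟩ / V(x*, x). -/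
open RealInnerProductSpace

/-- The closed ball centred at a point of a closed set `Q`, with radius the distance to the
boundary of `Q`, is contained in `Q`. -/
theorem closedBall_infDist_frontier_subset {E : Type*} [NormedAddCommGroup E] [NormedSpace ℝ E]
    {Q : Set E} (hQ : IsClosed Q) {c : E} (hc : c ∈ Q)
    (hpos : 0 < Metric.infDist c (frontier Q)) :
    Metric.closedBall c (Metric.infDist c (frontier Q)) ⊆ Q := by
  rw [← closure_ball c hpos.ne']
  have hcover : Metric.ball c (Metric.infDist c (frontier Q)) ⊆ interior Q ∪ Qᶜ := by
    intro y hy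
    by_contra h
    rw [Set.mem_union, Set.mem_compl_iff, not_or, not_not] at h
    have hyf : y ∈ frontier Q := ⟨subset_closure h.2, h.1⟩
    exact absurd (Metric.infDist_le_dist_of_mem hyf) (not_le.mpr (Metric.mem_ball'.mp hy))
  have hcball := Metric.mem_ball_self (x := c) hpos
  have hcint : c ∈ interior Q := (hcover hcball).resolve_right (not_not.mpr hc)
  exact closure_minimal (((convex_ball c _).isPreconnected.subset_left_of_subset_union
    isOpen_interior hQ.isOpen_compl
    (disjoint_compl_right.mono_left interior_subset) hcover
    ⟨c, hcball, hcint⟩).trans interior_subset) hQ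

/-- Scaling condition lemma: if `xstar` is an interior minimizer of `f` over
the convex compact set `Q`, `δ = dist(xstar, ∂Q) > 0`, `D = max_{x,y∈Q} ‖x−y‖`,
`D_V = max_{x,y∈Q} V(x,y)`, `ε > 0`, `x ∈ Q` with `g = −∇f x ≠ 0` and `V(xstar, x) > ε`,
and `s` maximizes `⟪g, ·⟫` over `Q` with `V(s,x) > 0`, then the scaling condition holds
with `τ = (δ/D)·(ε/D_V)`. -/
theorem stmt6 (n : ℕ) (Q : Set (EuclideanSpace ℝ (Fin n)))
    (hQconv : Convex ℝ Q) (hQcomp : IsCompact Q)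
    (href : EuclideanSpace ℝ (Fin n) → ℝ) (hrefDiff : Differentiable ℝ href)
    (hrefConv : ConvexOn ℝ Set.univ href)
    (V : EuclideanSpace ℝ (Fin n) → EuclideanSpace ℝ (Fin n) → ℝ)
    (hV : ∀ x y, V x y = href x - href y - ⟪gradient href y, x - y⟫)
    (f : EuclideanSpace ℝ (Fin n) → ℝ) (hfDiff : Differentiable ℝ f)
    (hfConv : ConvexOn ℝ Set.univ f)
    (xstar : EuclideanSpace ℝ (Fin n)) (hxstarInt : xstar ∈ interior Q)
    (hxstarMin : ∀ y ∈ Q, f xstar ≤ f y)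
    (δ : ℝ) (hδ : δ = Metric.infDist xstar (frontier Q)) (hδpos : 0 < δ)
    (D : ℝ) (hD : IsGreatest
      ((fun p : EuclideanSpace ℝ (Fin n) × EuclideanSpace ℝ (Fin n) => ‖p.1 - p.2‖) ''
        (Q ×ˢ Q)) D)
    (DV : ℝ) (hDV : IsGreatest
      ((fun p : EuclideanSpace ℝ (Fin n) × EuclideanSpace ℝ (Fin n) => V p.1 p.2) ''
        (Q ×ˢ Q)) DV)
    (ε : ℝ) (hε : 0 < ε)
    (x : EuclideanSpace ℝ (Fin n)) (hx : x ∈ Q) (hxne : x ≠ xstar)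
    (hg : -gradient f x ≠ 0) (hVx : ε < V xstar x)
    (s : EuclideanSpace ℝ (Fin n)) (hs : s ∈ Q)
    (hsmax : ∀ z ∈ Q, ⟪-gradient f x, z⟫ ≤ ⟪-gradient f x, s⟫)
    (hVs : 0 < V s x) :
    ⟪-gradient f x, s - x⟫ / V s x ≥
      δ / D * (ε / DV) * (⟪-gradient f x, xstar - x⟫ / V xstar x) := by
  have hball := closedBall_infDist_frontier_subset hQcomp.isClosed
    (interior_subset hxstarInt) (hδ ▸ hδpos)
  rw [← hδ] at hball
  set g := -gradient f x
  have hgpos : 0 < ‖g‖ := norm_pos_iff.mpr hg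
  have hmem : xstar + (δ / ‖g‖) • g ∈ Q := hball (by
    rw [Metric.mem_closedBall, dist_self_add_left, norm_smul, Real.norm_of_nonneg (by positivity),
      div_mul_cancel₀ _ hgpos.ne'])
  have hxstarQ : xstar ∈ Q := interior_subset hxstarInt
  have hnorm : ‖xstar - x‖ ≤ D := hD.2 ⟨(xstar, x), ⟨hxstarQ, hx⟩, rfl⟩
  have hDpos : 0 < D := (norm_pos_iff.mpr (sub_ne_zero.mpr hxne.symm)).trans_le hnorm
  have hVsDV : V s x ≤ DV := hDV.2 ⟨(s, x), ⟨hs, hx⟩, rfl⟩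
  have hDVpos : 0 < DV := hVs.trans_le hVsDV
  have hVxpos : 0 < V xstar x := hε.trans hVx
  have hd : 0 ≤ ⟪g, s - x⟫ := by
    rw [inner_sub_right]
    exact sub_nonneg.mpr (hsmax x hx)
  rcases le_or_gt ⟪g, xstar - x⟫ 0 with hA | hA
  · exact (mul_nonpos_of_nonneg_of_nonpos (by positivity)
      (div_nonpos_of_nonpos_of_nonneg hA hVxpos.le)).trans (div_nonneg hd hVs.le)
  have hgain : ⟪g, xstar - x⟫ + δ * ‖g‖ ≤ ⟪g, s - x⟫ := by
    have h := hsmax _ hmem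
    rw [inner_add_right, inner_smul_right, real_inner_self_eq_norm_sq] at h
    have h' : δ / ‖g‖ * ‖g‖ ^ 2 = δ * ‖g‖ := by field_simp
    rw [inner_sub_right, inner_sub_right]
    linarith
  have hCS : ⟪g, xstar - x⟫ ≤ ‖g‖ * D :=
    (real_inner_le_norm _ _).trans (by gcongr)
  have hkey : δ / D * ⟪g, xstar - x⟫ ≤ ⟪g, s - x⟫ :=
    calc δ / D * ⟪g, xstar - x⟫ ≤ δ / D * (‖g‖ * D) := by gcongr
      _ = δ * ‖g‖ := by field_simp
      _ ≤ ⟪g, s - x⟫ := by linarith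
  calc δ / D * (ε / DV) * (⟪g, xstar - x⟫ / V xstar x)
      = δ / D * ⟪g, xstar - x⟫ / DV * (ε / V xstar x) := by ring
    _ ≤ δ / D * ⟪g, xstar - x⟫ / DV * 1 := by
        gcongr
        exact (div_le_one hVxpos).mpr hVx.le
    _ = δ / D * ⟪g, xstar - x⟫ / DV := mul_one _
    _ ≤ ⟪g, s - x⟫ / DV := by gcongr
    _ ≤ ⟪g, s - x⟫ / V s x := by gcongr
end

section
/- Let Q ⊆ ℝⁿ be convex, V the Bregman divergence of a differentiable convex h, and f differentiable, convex, and μ-relatively strongly convex on Q with μ > 0. Let x* be a minimizer of f over Q with optimal value f*, and let x ∈ Q satisfy V(x*, x) > 0 and g := ⟨∇f(x), x − x*⟩ > 0. Then for every γ ∈ (1,2]: f(x) − f* ≤ ((γ−1)/γ^{γ/(γ−1)}) · g^{γ/(γ−1)} / (μ·V(x*, x))^{1/(γ−1)}. -/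
open RealInnerProductSpace

/-- The bound `g - w ≤ max_{α ≥ 0} (g * α - w * α ^ γ)`, with the maximum in closed form. -/
theorem sub_le_mul_rpow_conjugate {γ g w : ℝ} (hγ : 1 < γ) (hg : 0 < g) (hw : 0 < w) :
    g - w ≤ (γ - 1) / γ ^ (γ / (γ - 1)) * g ^ (γ / (γ - 1)) / w ^ (1 / (γ - 1)) := by
  have hγ0 : 0 < γ := by linarith
  have hγ1 : 0 < γ - 1 := by linarith
  obtain ⟨u, hu, rfl⟩ : ∃ u, 0 < u ∧ g = γ * w * u :=
    ⟨g / (γ * w), by positivity, by field_simp⟩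
  have hp : γ / (γ - 1) = 1 / (γ - 1) + 1 := by field_simp; ring
  have bernoulli : 1 + γ / (γ - 1) * (u - 1) ≤ u ^ (γ / (γ - 1)) := by
    have h := one_add_mul_self_le_rpow_one_add (s := u - 1) (by linarith)
      (p := γ / (γ - 1)) (by rw [le_div_iff₀ hγ1]; linarith)
    rwa [add_sub_cancel] at h
  have hwp : w ^ (γ / (γ - 1)) = w ^ (1 / (γ - 1)) * w := by
    rw [hp, Real.rpow_add_one hw.ne']
  have hrhs : (γ - 1) / γ ^ (γ / (γ - 1)) * (γ * w * u) ^ (γ / (γ - 1)) / w ^ (1 / (γ - 1))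
      = w * ((γ - 1) * u ^ (γ / (γ - 1))) := by
    have hγp := (Real.rpow_pos_of_pos hγ0 (γ / (γ - 1))).ne'
    have hwq := (Real.rpow_pos_of_pos hw (1 / (γ - 1))).ne'
    rw [Real.mul_rpow (by positivity) hu.le, Real.mul_rpow hγ0.le hw.le, hwp,
      div_mul_eq_mul_div, div_div, div_eq_iff (mul_ne_zero hγp hwq)]
    ring
  have hlhs : γ * w * u - w = w * ((γ - 1) * (1 + γ / (γ - 1) * (u - 1))) := by
    field_simp
    ring
  rw [hrhs, hlhs]
  gcongr

/-- if `f` is convex, differentiable and `μ`-relatively strongly convex on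
`Q`, `xstar` minimizes `f` over `Q`, `x ∈ Q` with `V(xstar, x) > 0` and
`g = ⟪∇f x, x − xstar⟫ > 0`, then for every `γ ∈ (1,2]`:
`f x − f* ≤ ((γ−1)/γ^{γ/(γ−1)}) · g^{γ/(γ−1)} / (μ·V(xstar,x))^{1/(γ−1)}`. -/
theorem stmt10 (n : ℕ) (Q : Set (EuclideanSpace ℝ (Fin n))) (hQconv : Convex ℝ Q)
    (href : EuclideanSpace ℝ (Fin n) → ℝ) (hrefDiff : Differentiable ℝ href)
    (hrefConv : ConvexOn ℝ Set.univ href)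
    (V : EuclideanSpace ℝ (Fin n) → EuclideanSpace ℝ (Fin n) → ℝ)
    (hV : ∀ x y, V x y = href x - href y - ⟪gradient href y, x - y⟫)
    (f : EuclideanSpace ℝ (Fin n) → ℝ) (hfDiff : Differentiable ℝ f)
    (hfConv : ConvexOn ℝ Set.univ f)
    (μ : ℝ) (hμ : 0 < μ)
    (hsc : ∀ x ∈ Q, ∀ y ∈ Q, f x ≥ f y + ⟪gradient f y, x - y⟫ + μ * V x y)
    (xstar : EuclideanSpace ℝ (Fin n)) (hxstarQ : xstar ∈ Q)
    (hxstarMin : ∀ y ∈ Q, f xstar ≤ f y)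
    (x : EuclideanSpace ℝ (Fin n)) (hx : x ∈ Q)
    (hVpos : 0 < V xstar x)
    (hg : 0 < ⟪gradient f x, x - xstar⟫) :
    ∀ γ ∈ Set.Ioc (1 : ℝ) 2,
      f x - f xstar ≤
        (γ - 1) / γ ^ (γ / (γ - 1)) * ⟪gradient f x, x - xstar⟫ ^ (γ / (γ - 1)) /
          (μ * V xstar x) ^ (1 / (γ - 1)) := by
  rintro γ ⟨hγ, -⟩
  have hgap := hsc xstar hxstarQ x hx
  rw [← neg_sub x xstar, inner_neg_right] at hgap
  have hbound := sub_le_mul_rpow_conjugate hγ hg (mul_pos hμ hVpos)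
  linarith
end

section
/- Let Q ⊆ ℝⁿ be convex and compact, V the Bregman divergence of a differentiable convex h, f convex and differentiable with minimizer x* over Q and f* = f(x*). Fix x ∈ Q, let s minimize z ↦ ⟨∇f(x), z⟩ over Q, d = s − x, V(s,x) > 0, L > 0, γ ∈ (1,2], and suppose the progress inequality f(x⁺) − f(x) ≤ (1/2)·⟨∇f(x), d⟩·( −⟨∇f(x), d⟩/(2L·V(s,x)) )^{1/(γ−1)} holds for the next iterate x⁺. Then, writing h = f(x) − f* and h⁺ = f(x⁺) − f*, one has h⁺ ≤ h·( 1 − (1/2)·( h/(2L·V(s,x)) )^{1/(γ−1)} ). -/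
open RealInnerProductSpace

/-- given the progress inequality
`f x⁺ − f x ≤ (1/2)·⟪∇f x, d⟫·(−⟪∇f x, d⟫/(2L·V(s,x)))^{1/(γ−1)}` for the Frank–Wolfe
direction `d = s − x`, writing `h = f x − f*` and `h⁺ = f x⁺ − f*`, one has
`h⁺ ≤ h·(1 − (1/2)·(h/(2L·V(s,x)))^{1/(γ−1)})`. -/
theorem stmt11 (n : ℕ) (Q : Set (EuclideanSpace ℝ (Fin n)))
    (hQconv : Convex ℝ Q) (hQcomp : IsCompact Q)
    (href : EuclideanSpace ℝ (Fin n) → ℝ) (hrefDiff : Differentiable ℝ href)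
    (hrefConv : ConvexOn ℝ Set.univ href)
    (V : EuclideanSpace ℝ (Fin n) → EuclideanSpace ℝ (Fin n) → ℝ)
    (hV : ∀ x y, V x y = href x - href y - ⟪gradient href y, x - y⟫)
    (f : EuclideanSpace ℝ (Fin n) → ℝ) (hfDiff : Differentiable ℝ f)
    (hfConv : ConvexOn ℝ Set.univ f)
    (xstar : EuclideanSpace ℝ (Fin n)) (hxstarQ : xstar ∈ Q)
    (hxstarMin : ∀ y ∈ Q, f xstar ≤ f y)
    (x : EuclideanSpace ℝ (Fin n)) (hx : x ∈ Q)
    (s : EuclideanSpace ℝ (Fin n)) (hs : s ∈ Q)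
    (hsmin : ∀ z ∈ Q, ⟪gradient f x, s⟫ ≤ ⟪gradient f x, z⟫)
    (hVpos : 0 < V s x)
    (L : ℝ) (hL : 0 < L) (γ : ℝ) (hγ : γ ∈ Set.Ioc (1 : ℝ) 2)
    (xplus : EuclideanSpace ℝ (Fin n))
    (hprog : f xplus - f x ≤
      1 / 2 * ⟪gradient f x, s - x⟫ *
        (-⟪gradient f x, s - x⟫ / (2 * L * V s x)) ^ (1 / (γ - 1))) :
    f xplus - f xstar ≤
      (f x - f xstar) *
        (1 - 1 / 2 * ((f x - f xstar) / (2 * L * V s x)) ^ (1 / (γ - 1))) := by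
  have hpos : 0 < 2 * L * V s x := by positivity
  have hgap : 0 ≤ f x - f xstar := sub_nonneg.2 (hxstarMin x hx)
  have hdual : f x - f xstar ≤ -⟪gradient f x, s - x⟫ := by
    have htangent := hfConv.inner_gradient_le_sub (hfDiff x) xstar
    have hmin := hsmin xstar hxstarQ
    rw [inner_sub_right] at htangent ⊢
    linarith
  have hexp : 0 ≤ 1 / (γ - 1) := one_div_nonneg.2 (sub_nonneg.2 hγ.1.le)
  have hpow : ((f x - f xstar) / (2 * L * V s x)) ^ (1 / (γ - 1)) ≤
      (-⟪gradient f x, s - x⟫ / (2 * L * V s x)) ^ (1 / (γ - 1)) := by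
    gcongr
  have hmul := mul_le_mul hdual hpow (by positivity) (hgap.trans hdual)
  linarith
end

section
/- Let F, F̃ : ℝⁿ → ℝ be differentiable functions satisfying the statistical similarity condition ‖(∇F(x) − ∇F̃(x)) − (∇F(y) − ∇F̃(y))‖ ≤ σ‖x − y‖ for all x, y ∈ ℝⁿ, with σ > 0. Define d_F̃(x) = F̃(x) + (σ/2)‖x‖² and its Bregman divergence V_F̃(y,x) = d_F̃(y) − d_F̃(x) − ⟨∇d_F̃(x), y − x⟩. Then F is 1-relatively smooth with respect to V_F̃: F(y) ≤ F(x) + ⟨∇F(x), y − x⟩ + V_F̃(y, x) for all x, y ∈ ℝⁿ. -/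
open RealInnerProductSpace

section Descent

variable {E : Type*} [NormedAddCommGroup E] [InnerProductSpace ℝ E] [CompleteSpace E]

/-- The descent lemma: a function with `σ`-Lipschitz gradient is bounded above by its
quadratic model. -/
theorem le_add_inner_add_sq_of_gradient_lipschitz {g : E → ℝ} {g' : E → E} {σ : ℝ}
    (hg : ∀ x, HasGradientAt g (g' x) x) (hlip : ∀ x y, ‖g' x - g' y‖ ≤ σ * ‖x - y‖) (x y : E) :
    g y ≤ g x + ⟪g' x, y - x⟫ + σ / 2 * ‖y - x‖ ^ 2 := by
  have hline (t : ℝ) : HasDerivAt (fun s : ℝ => x + s • (y - x)) (y - x) t := by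
    simpa using ((hasDerivAt_id t).smul_const (y - x)).const_add x
  have hf (t : ℝ) : HasDerivAt (fun s : ℝ => g (x + s • (y - x)))
      ⟪g' (x + t • (y - x)), y - x⟫ t := by
    have h := (hg (x + t • (y - x))).hasFDerivAt.comp_hasDerivAt t (hline t)
    rwa [InnerProductSpace.toDual_apply_apply] at h
  have hB (t : ℝ) : HasDerivAt
      (fun s : ℝ => g x + s * ⟪g' x, y - x⟫ + σ / 2 * ‖y - x‖ ^ 2 * s ^ 2)
      (⟪g' x, y - x⟫ + σ * ‖y - x‖ ^ 2 * t) t := by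
    refine ((((hasDerivAt_id t).mul_const ⟪g' x, y - x⟫).const_add (g x)).add
      ((hasDerivAt_pow 2 t).const_mul (σ / 2 * ‖y - x‖ ^ 2))).congr_deriv ?_
    norm_num
    ring
  have key := image_le_of_deriv_right_le_deriv_boundary (a := 0) (b := 1)
    (fun t _ => (hf t).continuousAt.continuousWithinAt)
    (fun t _ => (hf t).hasDerivWithinAt) (by simp)
    (fun t _ => (hB t).continuousAt.continuousWithinAt)
    (fun t _ => (hB t).hasDerivWithinAt) (fun t ht => by
      have h1 : ⟪g' (x + t • (y - x)) - g' x, y - x⟫ ≤ σ * ‖y - x‖ ^ 2 * t := calc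
        _ ≤ ‖g' (x + t • (y - x)) - g' x‖ * ‖y - x‖ := real_inner_le_norm _ _
        _ ≤ σ * ‖x + t • (y - x) - x‖ * ‖y - x‖ := by gcongr; exact hlip _ _
        _ = σ * ‖y - x‖ ^ 2 * t := by
          rw [add_sub_cancel_left, norm_smul, Real.norm_of_nonneg ht.1]; ring
      rw [inner_sub_left] at h1
      linarith) (Set.right_mem_Icc.2 zero_le_one)
  simpa using key

theorem hasGradientAt_half_mul_norm_sq (σ : ℝ) (x : E) :
    HasGradientAt (fun z : E => σ / 2 * ‖z‖ ^ 2) (σ • x) x := by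
  rw [hasGradientAt_iff_hasFDerivAt]
  refine ((hasStrictFDerivAt_norm_sq x).hasFDerivAt.const_mul (σ / 2)).congr_fderiv ?_
  ext v
  simp
  ring

end Descent

/-- under the statistical similarity condition
`‖(∇F x − ∇F̃ x) − (∇F y − ∇F̃ y)‖ ≤ σ‖x − y‖`, the function `F` is 1-relatively smooth with
respect to the Bregman divergence of `d_F̃(x) = F̃(x) + (σ/2)‖x‖²`:
`F y ≤ F x + ⟪∇F x, y − x⟫ + V_F̃(y, x)` for all `x, y`. -/
theorem stmt14 (n : ℕ) (F Ft : EuclideanSpace ℝ (Fin n) → ℝ)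
    (hF : Differentiable ℝ F) (hFt : Differentiable ℝ Ft)
    (σ : ℝ) (hσ : 0 < σ)
    (hsim : ∀ x y, ‖(gradient F x - gradient Ft x) - (gradient F y - gradient Ft y)‖ ≤
      σ * ‖x - y‖) :
    ∀ x y, F y ≤ F x + ⟪gradient F x, y - x⟫ +
      ((Ft y + σ / 2 * ‖y‖ ^ 2) - (Ft x + σ / 2 * ‖x‖ ^ 2) -
        ⟪gradient (fun z => Ft z + σ / 2 * ‖z‖ ^ 2) x, y - x⟫) := by
  intro x y
  have hsub (z) : HasGradientAt (fun w => F w - Ft w) (gradient F z - gradient Ft z) z := by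
    rw [hasGradientAt_iff_hasFDerivAt, map_sub]
    exact (hF z).hasGradientAt.hasFDerivAt.sub (hFt z).hasGradientAt.hasFDerivAt
  have hd : HasGradientAt (fun z => Ft z + σ / 2 * ‖z‖ ^ 2) (gradient Ft x + σ • x) x := by
    rw [hasGradientAt_iff_hasFDerivAt, map_add]
    exact (hFt x).hasGradientAt.hasFDerivAt.add (hasGradientAt_half_mul_norm_sq σ x).hasFDerivAt
  have hdesc := le_add_inner_add_sq_of_gradient_lipschitz hsub hsim x y
  have hsq : ‖y - x‖ ^ 2 = ‖y‖ ^ 2 - ‖x‖ ^ 2 - 2 * ⟪x, y - x⟫ := by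
    rw [norm_sub_sq_real, inner_sub_right, real_inner_self_eq_norm_sq, real_inner_comm]
    ring
  rw [hd.gradient, inner_add_left, real_inner_smul_left]
  rw [inner_sub_left, hsq] at hdesc
  linarith
end

section
/- Let F, F̃ : ℝⁿ → ℝ be differentiable, with F μ-strongly convex (F(y) ≥ F(x) + ⟨∇F(x), y − x⟩ + (μ/2)‖y − x‖² for all x,y) for some μ > 0, and satisfying the statistical similarity condition ‖(∇F(x) − ∇F̃(x)) − (∇F(y) − ∇F̃(y))‖ ≤ σ‖x − y‖ for all x, y, with σ > 0. Then for every C ∈ (0,1) and all x, y ∈ ℝⁿ: F(y) − F(x) − ⟨∇F(x), y − x⟩ ≥ C·[F̃(y) − F̃(x) − ⟨∇F̃(x), y − x⟩] + ((μ(1−C) − Cσ)/2)·‖y − x‖². -/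
open RealInnerProductSpace

/-- A function whose gradient is `σ`-Lipschitz relative to the base point `x` is bounded below by
its linearization at `x` minus a quadratic. -/
theorem HasGradientAt.linearization_sub_quadratic_le {E : Type*} [NormedAddCommGroup E]
    [InnerProductSpace ℝ E] [CompleteSpace E] {G : E → ℝ} {g : E → E} {σ : ℝ} {x : E}
    (hG : ∀ z, HasGradientAt G (g z) z) (hg : ∀ z, ‖g z - g x‖ ≤ σ * ‖z - x‖) (y : E) :
    G x + ⟪g x, y - x⟫ - σ / 2 * ‖y - x‖ ^ 2 ≤ G y := by
  set v := y - x with hv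
  let h : ℝ → ℝ := fun t ↦ G (x + t • v) - t * ⟪g x, v⟫ + σ / 2 * ‖v‖ ^ 2 * t ^ 2
  have hderiv (t : ℝ) :
      HasDerivAt h (⟪g (x + t • v), v⟫ - ⟪g x, v⟫ + σ / 2 * ‖v‖ ^ 2 * (2 * t)) t := by
    have hline : HasDerivAt (fun t : ℝ ↦ x + t • v) v t := by
      simpa using ((hasDerivAt_id t).smul_const v).const_add x
    have hcomp := (hG (x + t • v)).hasFDerivAt.comp_hasDerivAt t hline
    have hlin : HasDerivAt (fun t : ℝ ↦ t * ⟪g x, v⟫) ⟪g x, v⟫ t := by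
      simpa using (hasDerivAt_id t).mul_const ⟪g x, v⟫
    have hquad : HasDerivAt (fun t : ℝ ↦ σ / 2 * ‖v‖ ^ 2 * t ^ 2)
        (σ / 2 * ‖v‖ ^ 2 * (2 * t)) t := by
      simpa using (hasDerivAt_pow 2 t).const_mul (σ / 2 * ‖v‖ ^ 2)
    exact (hcomp.sub hlin).add hquad
  have hmono : MonotoneOn h (Set.Icc 0 1) := by
    refine monotoneOn_of_deriv_nonneg (convex_Icc 0 1)
      (fun t _ ↦ (hderiv t).continuousAt.continuousWithinAt)
      (fun t _ ↦ (hderiv t).differentiableAt.differentiableWithinAt) fun t ht ↦ ?_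
    rw [interior_Icc] at ht
    rw [(hderiv t).deriv, ← inner_sub_left]
    have hinner := neg_le_of_abs_le (abs_real_inner_le_norm (g (x + t • v) - g x) v)
    have hnorm := hg (x + t • v)
    rw [add_sub_cancel_left, norm_smul, Real.norm_of_nonneg ht.1.le] at hnorm
    linarith [mul_le_mul_of_nonneg_right hnorm (norm_nonneg v)]
  have hle := hmono (Set.left_mem_Icc.2 zero_le_one) (Set.right_mem_Icc.2 zero_le_one) zero_le_one
  simp only [h, zero_smul, add_zero, one_smul, hv, add_sub_cancel] at hle
  rw [hv]
  linarith

/-- if `F` is `μ`-strongly convex and the statistical similarity condition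
holds with constant `σ`, then for every `C ∈ (0,1)` and all `x, y`:
`F y − F x − ⟪∇F x, y − x⟫ ≥ C·[F̃ y − F̃ x − ⟪∇F̃ x, y − x⟫] + ((μ(1−C) − Cσ)/2)·‖y − x‖²`. -/
theorem stmt15 (n : ℕ) (F Ft : EuclideanSpace ℝ (Fin n) → ℝ)
    (hF : Differentiable ℝ F) (hFt : Differentiable ℝ Ft)
    (μ : ℝ) (hμ : 0 < μ)
    (hstrong : ∀ x y, F y ≥ F x + ⟪gradient F x, y - x⟫ + μ / 2 * ‖y - x‖ ^ 2)
    (σ : ℝ) (hσ : 0 < σ)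
    (hsim : ∀ x y, ‖(gradient F x - gradient Ft x) - (gradient F y - gradient Ft y)‖ ≤
      σ * ‖x - y‖) :
    ∀ C ∈ Set.Ioo (0 : ℝ) 1, ∀ x y,
      F y - F x - ⟪gradient F x, y - x⟫ ≥
        C * (Ft y - Ft x - ⟪gradient Ft x, y - x⟫) +
          (μ * (1 - C) - C * σ) / 2 * ‖y - x‖ ^ 2 := by
  rintro C ⟨hC0, hC1⟩ x y
  have hgrad (z) : HasGradientAt (fun z ↦ F z - Ft z) (gradient F z - gradient Ft z) z := by
    rw [hasGradientAt_iff_hasFDerivAt, map_sub]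
    exact (hF z).hasGradientAt.hasFDerivAt.sub (hFt z).hasGradientAt.hasFDerivAt
  have hlower := HasGradientAt.linearization_sub_quadratic_le hgrad (fun z ↦ hsim z x) y
  rw [inner_sub_left] at hlower
  linarith [mul_le_mul_of_nonneg_left hlower hC0.le,
    mul_le_mul_of_nonneg_left (hstrong x y) (sub_nonneg.2 hC1.le)]
end

section
/- Let F, F̃ : ℝⁿ → ℝ be differentiable, with F μ-strongly convex for some μ > 0, and satisfying the statistical similarity condition ‖(∇F(x) − ∇F̃(x)) − (∇F(y) − ∇F̃(y))‖ ≤ σ‖x − y‖ for all x, y, with σ > 0. Define d_F̃(x) = F̃(x) + (σ/2)‖x‖² and its Bregman divergence V_F̃(y,x) = d_F̃(y) − d_F̃(x) − ⟨∇d_F̃(x), y − x⟩. Then F is (μ/(μ + 2σ))-relatively strongly convex with respect to V_F̃: F(y) ≥ F(x) + ⟨∇F(x), y − x⟩ + (μ/(μ + 2σ))·V_F̃(y, x) for all x, y ∈ ℝⁿ. -/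
open RealInnerProductSpace

section

variable {E : Type*} [NormedAddCommGroup E] [InnerProductSpace ℝ E] [CompleteSpace E]

/-- The descent lemma: a function with `σ`-Lipschitz gradient is bounded above by its quadratic
model. -/
theorem le_add_inner_gradient_add_sq {G : E → ℝ} {g : E → E}
    (hG : ∀ x, HasGradientAt G (g x) x) {σ : ℝ}
    (hg : ∀ x y, ‖g x - g y‖ ≤ σ * ‖x - y‖) (x y : E) :
    G y ≤ G x + ⟪g x, y - x⟫ + σ / 2 * ‖y - x‖ ^ 2 := by
  set h := y - x with hh
  let φ : ℝ → ℝ := fun t => G (x + t • h) - t * ⟪g x, h⟫ - t ^ 2 * (σ / 2 * ‖h‖ ^ 2)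
  have hφ (t : ℝ) : HasDerivAt φ
      (⟪g (x + t • h), h⟫ - ⟪g x, h⟫ - 2 * t * (σ / 2 * ‖h‖ ^ 2)) t := by
    have hline : HasDerivAt (fun t : ℝ => x + t • h) h t := by
      simpa using ((hasDerivAt_id t).smul_const h).const_add x
    have hcomp : HasDerivAt (fun t : ℝ => G (x + t • h)) ⟪g (x + t • h), h⟫ t := by
      simpa [Function.comp_def] using (hG (x + t • h)).hasFDerivAt.comp_hasDerivAt t hline
    have hlin := (hasDerivAt_id t).mul_const ⟪g x, h⟫
    have hsq := (hasDerivAt_pow 2 t).mul_const (σ / 2 * ‖h‖ ^ 2)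
    exact ((hcomp.sub hlin).sub hsq).congr_deriv (by simp)
  have hanti : AntitoneOn φ (Set.Icc 0 1) := by
    refine antitoneOn_of_deriv_nonpos (convex_Icc 0 1)
      (fun t _ => (hφ t).continuousAt.continuousWithinAt)
      (fun t _ => (hφ t).differentiableAt.differentiableWithinAt) fun t ht => ?_
    rw [interior_Icc] at ht
    rw [(hφ t).deriv, ← inner_sub_left]
    have hlip := hg (x + t • h) x
    rw [add_sub_cancel_left, norm_smul, Real.norm_of_nonneg ht.1.le] at hlip
    have hcs := real_inner_le_norm (g (x + t • h) - g x) h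
    nlinarith [mul_le_mul_of_nonneg_right hlip (norm_nonneg h)]
  have h01 := hanti (Set.left_mem_Icc.2 zero_le_one) (Set.right_mem_Icc.2 zero_le_one) zero_le_one
  simp only [φ, zero_smul, one_smul, add_zero] at h01
  rw [hh, add_sub_cancel] at h01
  rw [hh]
  linarith

theorem HasGradientAt.add_mul_norm_sq {f : E → ℝ} {f' x : E} (hf : HasGradientAt f f' x) (c : ℝ) :
    HasGradientAt (fun z => f z + c / 2 * ‖z‖ ^ 2) (f' + c • x) x := by
  rw [hasGradientAt_iff_hasFDerivAt] at hf ⊢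
  refine (hf.add (((hasStrictFDerivAt_norm_sq x).hasFDerivAt).const_mul (c / 2))).congr_fderiv ?_
  ext v
  simp
  ring

end

/-- if `F` is `μ`-strongly convex and the statistical similarity condition
holds with constant `σ`, then `F` is `(μ/(μ+2σ))`-relatively strongly convex with respect to
the Bregman divergence of `d_F̃(x) = F̃(x) + (σ/2)‖x‖²`:
`F y ≥ F x + ⟪∇F x, y − x⟫ + (μ/(μ+2σ))·V_F̃(y, x)` for all `x, y`. -/
theorem stmt16 (n : ℕ) (F Ft : EuclideanSpace ℝ (Fin n) → ℝ)
    (hF : Differentiable ℝ F) (hFt : Differentiable ℝ Ft)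
    (μ : ℝ) (hμ : 0 < μ)
    (hstrong : ∀ x y, F y ≥ F x + ⟪gradient F x, y - x⟫ + μ / 2 * ‖y - x‖ ^ 2)
    (σ : ℝ) (hσ : 0 < σ)
    (hsim : ∀ x y, ‖(gradient F x - gradient Ft x) - (gradient F y - gradient Ft y)‖ ≤
      σ * ‖x - y‖) :
    ∀ x y, F y ≥ F x + ⟪gradient F x, y - x⟫ +
      μ / (μ + 2 * σ) *
        ((Ft y + σ / 2 * ‖y‖ ^ 2) - (Ft x + σ / 2 * ‖x‖ ^ 2) -
          ⟪gradient (fun z => Ft z + σ / 2 * ‖z‖ ^ 2) x, y - x⟫) := by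
  intro x y
  have hdiff (z) : HasGradientAt (fun w => Ft w - F w) (gradient Ft z - gradient F z) z := by
    rw [hasGradientAt_iff_hasFDerivAt, map_sub]
    exact (hFt z).hasGradientAt.hasFDerivAt.sub (hF z).hasGradientAt.hasFDerivAt
  have hlip (u v) : ‖(gradient Ft u - gradient F u) - (gradient Ft v - gradient F v)‖ ≤
      σ * ‖u - v‖ := by
    have hneg : (gradient Ft u - gradient F u) - (gradient Ft v - gradient F v) =
        -((gradient F u - gradient Ft u) - (gradient F v - gradient Ft v)) := by abel
    rw [hneg, norm_neg]
    exact hsim u v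
  have hdesc := le_add_inner_gradient_add_sq hdiff hlip x y
  have hexp : ‖y‖ ^ 2 = ‖x‖ ^ 2 + 2 * ⟪x, y - x⟫ + ‖y - x‖ ^ 2 := by
    rw [← norm_add_sq_real, add_sub_cancel]
  have hs := hstrong x y
  rw [((hFt x).hasGradientAt.add_mul_norm_sq σ).gradient, inner_add_left, real_inner_smul_left,
    hexp]
  rw [inner_sub_left] at hdesc
  have hpos : 0 < μ + 2 * σ := by positivity
  rw [ge_iff_le, ← le_sub_iff_add_le', div_mul_eq_mul_div, div_le_iff₀ hpos]
  nlinarith [mul_le_mul_of_nonneg_left hdesc hμ.le, mul_le_mul_of_nonneg_left hs hσ.le]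
end
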